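/- There is an absolute constant C such that the following holds. For every finite alphabet Σ, all integers k ≥ 1, n ≥ 2, ℓ ≥ 1, and all NFAs M₁, …, M_k over Σ, each with exactly n states, there exists a CNF formula ψ with at most C·(k + n + ℓ + |Σ|)^C variables and clauses, together with a path decomposition of ψ of width at most (k + 1)·⌈log₂ n⌉ + |Σ| + C, such that ψ is satisfiable if and only if there exists a word w ∈ Σ* of length exactly ℓ that is accepted by every M_i. -/

import Mathlib

open scoped Classical

namespace PPSETH

abbrev Var := ℕ
abbrev Clause := Finset (Var × Bool)
abbrev CNF := List Clause

/-- The set of variables occurring in a clause. -/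
def clauseVars (c : Clause) : Finset Var := c.image Prod.fst

/-- The set of variables occurring in a CNF formula. -/
def cnfVars (φ : CNF) : Finset Var := φ.foldr (fun c s => clauseVars c ∪ s) ∅

/-- An assignment satisfies a clause if the clause contains a literal it makes true. -/
def SatC (τ : Var → Bool) (c : Clause) : Prop := ∃ l ∈ c, τ l.1 = l.2

/-- An assignment satisfies a CNF formula if it satisfies every clause. -/
def Sat (τ : Var → Bool) (φ : CNF) : Prop := ∀ c ∈ φ, SatC τ c

def Satisfiable (φ : CNF) : Prop := ∃ τ, Sat τ φ

/-- Size of a CNF formula: number of variables plus total number of literal occurrences. -/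
def size (φ : CNF) : ℕ := (cnfVars φ).card + (φ.map Finset.card).sum

/-- Weight of an assignment: the number of variables of the formula set to true. -/
def weight (φ : CNF) (τ : Var → Bool) : ℕ :=
  ((cnfVars φ).filter (fun x => τ x = true)).card

/-- The number of clauses (with multiplicity) satisfied by an assignment. -/
noncomputable def satCount (φ : CNF) (τ : Var → Bool) : ℕ :=
  (φ.map (fun c => if SatC τ c then 1 else 0)).sum

/-- Number of clauses (with multiplicity) in which a variable occurs. -/
noncomputable def occs (φ : CNF) (x : Var) : ℕ :=
  (φ.map (fun c => if x ∈ clauseVars c then 1 else 0)).sum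

/-- A k-CNF formula: every clause has at most k literals. -/
def IsKCNF (k : ℕ) (φ : CNF) : Prop := ∀ c ∈ φ, c.card ≤ k

/-- Structural conditions for a path decomposition of (the primal graph of) a CNF formula. -/
def PDOn (φ : CNF) (B : List (Finset Var)) : Prop :=
  (∀ b ∈ B, b ⊆ cnfVars φ) ∧
  (∀ x ∈ cnfVars φ, ∃ b ∈ B, x ∈ b) ∧
  (∀ c ∈ φ, ∃ b ∈ B, clauseVars c ⊆ b) ∧
  (∀ x : Var, ∀ i j k : ℕ, i ≤ j → j ≤ k →
    x ∈ B.getD i ∅ → x ∈ B.getD k ∅ → x ∈ B.getD j ∅)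

/-- A path decomposition of a CNF formula of width `p`: bags have size at most `p + 1`. -/
def PD (φ : CNF) (p : ℕ) (B : List (Finset Var)) : Prop :=
  PDOn φ B ∧ ∀ b ∈ B, b.card ≤ p + 1

section ProductEncoding

open Finset

theorem mem_cnfVars {φ : CNF} {x : Var} : x ∈ cnfVars φ ↔ ∃ c ∈ φ, x ∈ clauseVars c := by
  induction φ with
  | nil => simp [cnfVars]
  | cons c φ ih =>
    have h : cnfVars (c :: φ) = clauseVars c ∪ cnfVars φ := rfl
    simp [h, ih]

theorem satC_union {τ : Var → Bool} {c d : Clause} :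
    SatC τ (c ∪ d) ↔ SatC τ c ∨ SatC τ d := by
  simp only [SatC, mem_union, or_and_right, exists_or]

theorem clauseVars_union (c d : Clause) : clauseVars (c ∪ d) = clauseVars c ∪ clauseVars d :=
  image_union _ _

/-- Membership in `NFA.evalFrom` in terms of runs. -/
theorem mem_evalFrom_iff_exists_run {α σ : Type*} (M : NFA α σ) (w : List α) (S : Set σ) (q : σ) :
    q ∈ M.evalFrom S w ↔ ∃ s : ℕ → σ, s 0 ∈ S ∧ s w.length = q ∧
      ∀ t (h : t < w.length), s (t + 1) ∈ M.step (s t) w[t] := by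
  induction w generalizing S with
  | nil =>
    constructor
    · intro h
      exact ⟨fun _ => q, h, rfl, fun t ht => by simp at ht⟩
    · rintro ⟨s, h0, rfl, -⟩
      exact h0
  | cons a w ih =>
    rw [NFA.evalFrom_cons, ih]
    constructor
    · rintro ⟨s, h0, hq, hs⟩
      obtain ⟨p, hp, hps⟩ := M.mem_stepSet.1 h0
      refine ⟨fun t => Nat.casesOn t p s, hp, hq, ?_⟩
      rintro (_ | t) ht
      · exact hps
      · exact hs t (by simpa using ht)
    · rintro ⟨s, h0, hq, hs⟩
      refine ⟨fun t => s (t + 1), M.mem_stepSet.2 ⟨s 0, h0, hs 0 (by simp)⟩, hq, ?_⟩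
      intro t ht
      exact hs (t + 1) (by simpa using ht)

variable {α : Type} {k n ℓ b : ℕ}

/-- Names of the variables of the encoding: `inl (m, r)` is bit `r` of the `m`-th state block, and
`inr (t, a)` says that the `t`-th letter is `a`. Block `t * k + i` holds the state of the `i`-th
automaton at time `t`. -/
abbrev VarName (α : Type) (b : ℕ) := (ℕ × Fin b) ⊕ (ℕ × α)

/-- The clause saying that the `m`-th block does not hold `v`. -/
def blockNe (e : VarName α b → Var) (m : ℕ) (v : Fin b → Bool) : Clause :=
  univ.image fun r => (e (.inl (m, r)), !v r)

/-- The content of the `m`-th block under an assignment. -/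
def block (e : VarName α b → Var) (τ : Var → Bool) (m : ℕ) : Fin b → Bool :=
  fun r => τ (e (.inl (m, r)))

/-- The clause excluding a transition of the `i`-th automaton from `v` to `v'` by `a` at time
`t`. -/
def noTransition (e : VarName α b → Var) (k t i : ℕ) (v v' : Fin b → Bool) (a : α) : Clause :=
  blockNe e (t * k + i) v ∪ blockNe e ((t + 1) * k + i) v' ∪ {(e (.inr (t, a)), false)}

theorem satC_blockNe {e : VarName α b → Var} {τ : Var → Bool} {m : ℕ} {v : Fin b → Bool} :
    SatC τ (blockNe e m v) ↔ block e τ m ≠ v := by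
  simp [SatC, blockNe, block, Function.ne_iff, Bool.eq_not]

theorem satC_noTransition {e : VarName α b → Var} {τ : Var → Bool} {t i : ℕ}
    {v v' : Fin b → Bool} {a : α} :
    SatC τ (noTransition e k t i v v' a) ↔
      (block e τ (t * k + i) = v → block e τ ((t + 1) * k + i) = v' →
        τ (e (.inr (t, a))) = false) := by
  have h : SatC τ {(e (.inr (t, a)), false)} ↔ τ (e (.inr (t, a))) = false := by simp [SatC]
  rw [noTransition, satC_union, satC_union, satC_blockNe, satC_blockNe, h]
  tauto

variable [Fintype α]

/-- The clause saying that some letter is read at time `t`. -/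
def someLetter (e : VarName α b → Var) (t : ℕ) : Clause :=
  univ.image fun a => (e (.inr (t, a)), true)

theorem satC_someLetter {e : VarName α b → Var} {τ : Var → Bool} {t : ℕ} :
    SatC τ (someLetter e t) ↔ ∃ a, τ (e (.inr (t, a))) = true := by
  simp [SatC, someLetter]

/-- The clauses saying that the blocks describe accepting runs of the automata `M i` over a common
word of length `ℓ`. Bit vectors are turned into states by `dec`. -/
noncomputable def runClauses (e : VarName α b → Var) (dec : (Fin b → Bool) → Fin n) (ℓ : ℕ)
    (M : Fin k → NFA α (Fin n)) : Finset Clause :=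
  (univ : Finset (Fin ℓ)).image (fun t : Fin ℓ => someLetter e t) ∪
  (univ.filter fun x : Fin k × (Fin b → Bool) => dec x.2 ∉ (M x.1).start).image
    (fun x => blockNe e x.1 x.2) ∪
  (univ.filter fun x : Fin k × (Fin b → Bool) => dec x.2 ∉ (M x.1).accept).image
    (fun x => blockNe e (ℓ * k + x.1) x.2) ∪
  (univ.filter fun x : Fin ℓ × Fin k × (Fin b → Bool) × (Fin b → Bool) × α =>
      dec x.2.2.2.1 ∉ (M x.2.1).step (dec x.2.2.1) x.2.2.2.2).image
    (fun x => noTransition e k x.1 x.2.1 x.2.2.1 x.2.2.2.1 x.2.2.2.2)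

theorem forall_mem_runClauses {e : VarName α b → Var} {dec : (Fin b → Bool) → Fin n}
    {M : Fin k → NFA α (Fin n)} {P : Clause → Prop} :
    (∀ c ∈ runClauses e dec ℓ M, P c) ↔
      (∀ t : Fin ℓ, P (someLetter e t)) ∧
      (∀ (i : Fin k) v, dec v ∉ (M i).start → P (blockNe e i v)) ∧
      (∀ (i : Fin k) v, dec v ∉ (M i).accept → P (blockNe e (ℓ * k + i) v)) ∧
      (∀ (t : Fin ℓ) (i : Fin k) v v' a, dec v' ∉ (M i).step (dec v) a →
        P (noTransition e k t i v v' a)) := by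
  simp only [runClauses, forall_mem_union, forall_mem_image, mem_filter, mem_univ, true_and,
    Prod.forall, and_assoc, true_imp_iff]

theorem card_runClauses_le (e : VarName α b → Var) (dec : (Fin b → Bool) → Fin n)
    (M : Fin k → NFA α (Fin n)) :
    (runClauses e dec ℓ M).card ≤
      ℓ + k * 2 ^ b + k * 2 ^ b + ℓ * (k * (2 ^ b * (2 ^ b * Fintype.card α))) := by
  refine (card_union_le _ _).trans (Nat.add_le_add ((card_union_le _ _).trans
    (Nat.add_le_add ((card_union_le _ _).trans (Nat.add_le_add ?_ ?_)) ?_)) ?_)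
  · exact card_image_le.trans (by simp)
  all_goals exact card_image_le.trans ((card_filter_le _ _).trans (by simp))

theorem sat_runClauses_iff {e : VarName α b → Var} {dec : (Fin b → Bool) → Fin n}
    {M : Fin k → NFA α (Fin n)} {τ : Var → Bool} :
    Sat τ (runClauses e dec ℓ M).toList ↔
      (∀ t : Fin ℓ, ∃ a, τ (e (.inr (t.val, a))) = true) ∧
      (∀ i : Fin k, dec (block e τ i) ∈ (M i).start) ∧
      (∀ i : Fin k, dec (block e τ (ℓ * k + i)) ∈ (M i).accept) ∧
      (∀ (t : Fin ℓ) (i : Fin k) a, τ (e (.inr (t.val, a))) = true →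
        dec (block e τ ((t + 1) * k + i)) ∈ (M i).step (dec (block e τ (t * k + i))) a) := by
  simp only [Sat, mem_toList]
  rw [forall_mem_runClauses]
  simp only [satC_someLetter, satC_blockNe, satC_noTransition]
  refine and_congr Iff.rfl (and_congr ?_ (and_congr ?_ ?_))
  · exact ⟨fun h i => by_contra fun hi => h i _ hi rfl, fun h i v hv hb => hv (hb ▸ h i)⟩
  · exact ⟨fun h i => by_contra fun hi => h i _ hi rfl, fun h i v hv hb => hv (hb ▸ h i)⟩
  · constructor
    · intro h t i a ha
      by_contra hs
      simp [h t i _ _ a hs rfl rfl] at ha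
    · intro h t i v v' a hs hv hv'
      subst hv hv'
      by_contra ha
      exact hs (h t i a (by simpa using ha))

theorem satisfiable_runClauses_iff {e : VarName α b → Var} (he : Function.Injective e)
    {dec : (Fin b → Bool) → Fin n} (hdec : Function.Surjective dec) {M : Fin k → NFA α (Fin n)} :
    Satisfiable (runClauses e dec ℓ M).toList ↔
      ∃ w : List α, w.length = ℓ ∧ ∀ i, w ∈ (M i).accepts := by
  simp only [Satisfiable, sat_runClauses_iff]
  constructor
  · rintro ⟨τ, hletter, hstart, haccept, hstep⟩
    choose a ha using hletter
    refine ⟨List.ofFn a, by simp, fun i => NFA.mem_accepts.2 ⟨_, haccept i, ?_⟩⟩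
    rw [mem_evalFrom_iff_exists_run]
    refine ⟨fun t => dec (block e τ (t * k + i)), by simpa using hstart i, by simp, ?_⟩
    intro t ht
    have ht' : t < ℓ := by simpa using ht
    simpa using hstep ⟨t, ht'⟩ i _ (ha ⟨t, ht'⟩)
  · rintro ⟨w, rfl, hw⟩
    have hrun : ∀ i, ∃ s : ℕ → Fin n, s 0 ∈ (M i).start ∧ s w.length ∈ (M i).accept ∧
        ∀ t (h : t < w.length), s (t + 1) ∈ (M i).step (s t) w[t] := by
      intro i
      obtain ⟨q, hq, hqw⟩ := NFA.mem_accepts.1 (hw i)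
      obtain ⟨s, h0, rfl, hs⟩ := (mem_evalFrom_iff_exists_run _ _ _ _).1 hqw
      exact ⟨s, h0, hq, hs⟩
    choose s h0 hacc hs using hrun
    choose enc henc using hdec
    let f : VarName α b → Bool := Sum.elim
      (fun x => if h : x.1 % k < k then enc (s ⟨x.1 % k, h⟩ (x.1 / k)) x.2 else false)
      (fun x => decide (w[x.1]? = some x.2))
    let τ : Var → Bool := Function.extend e f fun _ => false
    have hτ : ∀ x, τ (e x) = f x := fun x => he.extend_apply _ _ _
    have hblock : ∀ (t : ℕ) (i : Fin k), dec (block e τ (t * k + i)) = s i t := by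
      intro t i
      have hk : 0 < k := i.pos
      have hmod : (t * k + i.val) % k = i := by
        rw [mul_comm, Nat.mul_add_mod, Nat.mod_eq_of_lt i.isLt]
      have hdiv : (t * k + i.val) / k = t := by
        rw [mul_comm, Nat.mul_add_div hk, Nat.div_eq_of_lt i.isLt, add_zero]
      have hb : block e τ (t * k + i) = enc (s i t) := by
        funext r
        simp [block, hτ, f, hmod, hdiv]
      rw [hb, henc]
    have hblock0 : ∀ i : Fin k, dec (block e τ i) = s i 0 := fun i => by
      simpa using hblock 0 i
    refine ⟨τ, fun t => ⟨w[t], by simp [hτ, f]⟩, fun i => ?_, fun i => ?_, fun t i a ha => ?_⟩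
    · rw [hblock0]
      exact h0 i
    · rw [hblock]
      exact hacc i
    · rw [hblock, hblock]
      have hwa : w[t] = a := by simpa [hτ, f] using ha
      exact hwa ▸ hs i t t.isLt

/-- The variables of blocks `p, …, p + k` and those of letter `p / k`. -/
def window (e : VarName α b → Var) (k p : ℕ) : Finset Var :=
  (Icc p (p + k) ×ˢ (univ : Finset (Fin b))).image (fun x => e (.inl x)) ∪
  (univ : Finset α).image fun a => e (.inr (p / k, a))

theorem card_window_le (e : VarName α b → Var) (k p : ℕ) :
    (window e k p).card ≤ (k + 1) * b + Fintype.card α := by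
  refine (card_union_le _ _).trans (Nat.add_le_add (card_image_le.trans ?_)
    (card_image_le.trans (by simp)))
  rw [card_product, Nat.card_Icc, card_univ, Fintype.card_fin]
  exact Nat.mul_le_mul_right _ (by omega)

theorem inl_mem_window {e : VarName α b → Var} (he : Function.Injective e) {p m : ℕ} {r : Fin b} :
    e (.inl (m, r)) ∈ window e k p ↔ p ≤ m ∧ m ≤ p + k := by
  simp [window, he.eq_iff]

theorem inr_mem_window {e : VarName α b → Var} (he : Function.Injective e) {p t : ℕ} {a : α} :
    e (.inr (t, a)) ∈ window e k p ↔ p / k = t := by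
  simp [window, he.eq_iff]

theorem window_interval {e : VarName α b → Var} (he : Function.Injective e) {p q r : ℕ}
    (hpq : p ≤ q) (hqr : q ≤ r) {x : Var} (hp : x ∈ window e k p) (hr : x ∈ window e k r) :
    x ∈ window e k q := by
  obtain ⟨y, rfl⟩ : ∃ y, e y = x := by
    rcases mem_union.1 hp with h | h <;> obtain ⟨_, -, h⟩ := mem_image.1 h <;> exact ⟨_, h⟩
  rcases y with ⟨m, i⟩ | ⟨t, a⟩
  · rw [inl_mem_window he] at *
    omega
  · rw [inr_mem_window he] at *
    exact le_antisymm (hr ▸ Nat.div_le_div_right hqr) (hp ▸ Nat.div_le_div_right hpq)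

theorem clauseVars_blockNe_subset {e : VarName α b → Var} (he : Function.Injective e) {p m : ℕ}
    {v : Fin b → Bool} (hpm : p ≤ m) (hmp : m ≤ p + k) :
    clauseVars (blockNe e m v) ⊆ window e k p := by
  intro x hx
  simp only [clauseVars, blockNe, mem_image, mem_univ, true_and, exists_exists_eq_and] at hx
  obtain ⟨r, rfl⟩ := hx
  exact (inl_mem_window he).2 ⟨hpm, hmp⟩

theorem exists_window_of_mem_runClauses {e : VarName α b → Var} (he : Function.Injective e)
    (hk : 1 ≤ k) (hℓ : 1 ≤ ℓ) {dec : (Fin b → Bool) → Fin n} {M : Fin k → NFA α (Fin n)} :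
    ∀ c ∈ runClauses e dec ℓ M, ∃ p < ℓ * k, clauseVars c ⊆ window e k p := by
  have hpos : ∀ (t : Fin ℓ) (i : Fin k), t * k + i.val < ℓ * k := fun t i => by
    have := Nat.mul_le_mul_right k (Nat.succ_le_of_lt t.isLt)
    have := i.isLt
    rw [Nat.succ_mul] at *
    omega
  have hdiv : ∀ (t : ℕ) (i : Fin k), (t * k + i.val) / k = t := fun t i => by
    rw [mul_comm, Nat.mul_add_div hk, Nat.div_eq_of_lt i.isLt, add_zero]
  have hkl : k ≤ ℓ * k := Nat.le_mul_of_pos_left k hℓ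
  rw [forall_mem_runClauses]
  refine ⟨fun t => ?_, fun i v _ => ?_, fun i v _ => ?_, fun t i v v' a _ => ?_⟩
  · refine ⟨_, hpos t ⟨0, hk⟩, fun x hx => ?_⟩
    simp only [clauseVars, someLetter, mem_image, mem_univ, true_and, exists_exists_eq_and] at hx
    obtain ⟨a, rfl⟩ := hx
    exact (inr_mem_window he).2 (hdiv t ⟨0, hk⟩)
  · have := i.isLt
    exact ⟨0, by omega, clauseVars_blockNe_subset he (by omega) (by omega)⟩
  · have := i.isLt
    exact ⟨ℓ * k - k + i, by omega, clauseVars_blockNe_subset he (by omega) (by omega)⟩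
  · refine ⟨_, hpos t i, ?_⟩
    rw [noTransition, clauseVars_union, clauseVars_union]
    refine union_subset (union_subset (clauseVars_blockNe_subset he le_rfl (by omega))
      (clauseVars_blockNe_subset he ?_ ?_)) ?_
    · rw [Nat.succ_mul]
      omega
    · rw [Nat.succ_mul]
      omega
    · intro x hx
      obtain rfl : e (.inr (t.val, a)) = x := by simpa [clauseVars, eq_comm] using hx
      exact (inr_mem_window he).2 (hdiv t i)

/-- A family of finite sets covering all clauses and satisfying the interval condition yields a
path decomposition. -/
theorem pd_of_windows {φ : CNF} {W : ℕ → Finset Var} {N p : ℕ}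
    (hcover : ∀ c ∈ φ, ∃ i < N, clauseVars c ⊆ W i)
    (hint : ∀ i j r, i ≤ j → j ≤ r → ∀ x, x ∈ W i → x ∈ W r → x ∈ W j)
    (hcard : ∀ i, (W i).card ≤ p + 1) :
    PD φ p ((List.range N).map fun i => W i ∩ cnfVars φ) := by
  have hsub : ∀ c ∈ φ, clauseVars c ⊆ cnfVars φ := fun c hc x hx => mem_cnfVars.2 ⟨c, hc, hx⟩
  have hget : ∀ x i, x ∈ ((List.range N).map fun i => W i ∩ cnfVars φ).getD i ∅ ↔
      i < N ∧ x ∈ W i ∧ x ∈ cnfVars φ := by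
    intro x i
    by_cases hi : i < N <;> simp [List.getD, hi]
  have hbag : ∀ c ∈ φ, ∃ b ∈ (List.range N).map fun i => W i ∩ cnfVars φ, clauseVars c ⊆ b := by
    intro c hc
    obtain ⟨i, hi, hci⟩ := hcover c hc
    exact ⟨_, List.mem_map.2 ⟨i, List.mem_range.2 hi, rfl⟩, subset_inter hci (hsub c hc)⟩
  refine ⟨⟨?_, ?_, hbag, ?_⟩, ?_⟩
  · intro b hb
    obtain ⟨i, -, rfl⟩ := List.mem_map.1 hb
    exact inter_subset_right
  · intro x hx
    obtain ⟨c, hc, hxc⟩ := mem_cnfVars.1 hx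
    obtain ⟨b, hb, hcb⟩ := hbag c hc
    exact ⟨b, hb, hcb hxc⟩
  · intro x i j r hij hjr hi hr
    rw [hget] at *
    exact ⟨by omega, hint i j r hij hjr x hi.2.1 hr.2.1, hi.2.2⟩
  · intro b hb
    obtain ⟨i, -, rfl⟩ := List.mem_map.1 hb
    exact (card_le_card inter_subset_left).trans (hcard i)

theorem card_cnfVars_le_of_windows {φ : CNF} {W : ℕ → Finset Var} {N p : ℕ}
    (hcover : ∀ c ∈ φ, ∃ i < N, clauseVars c ⊆ W i) (hcard : ∀ i, (W i).card ≤ p) :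
    (cnfVars φ).card ≤ N * p := by
  have h : cnfVars φ ⊆ (range N).biUnion W := fun x hx => by
    obtain ⟨c, hc, hxc⟩ := mem_cnfVars.1 hx
    obtain ⟨i, hi, hci⟩ := hcover c hc
    exact mem_biUnion.2 ⟨i, mem_range.2 hi, hci hxc⟩
  refine (card_le_card h).trans ((card_biUnion_le_card_mul _ _ p fun i _ => hcard i).trans ?_)
  rw [card_range]

theorem exists_surjective_bits (hn : 1 ≤ n) :
    ∃ dec : (Fin (Nat.clog 2 n) → Bool) → Fin n, Function.Surjective dec := by
  have : Nonempty (Fin n) := ⟨⟨0, hn⟩⟩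
  obtain ⟨g⟩ := Function.Embedding.nonempty_of_card_le
    (α := Fin n) (β := Fin (Nat.clog 2 n) → Bool)
    (by simpa using Nat.le_pow_clog one_lt_two n)
  exact ⟨_, Function.invFun_surjective g.injective⟩

theorem two_pow_clog_le (hn : 2 ≤ n) : 2 ^ Nat.clog 2 n ≤ 2 * n := by
  have h := Nat.pow_pred_clog_lt_self one_lt_two hn
  have hpos : 0 < Nat.clog 2 n := Nat.clog_pos one_lt_two hn
  obtain ⟨c, hc⟩ := Nat.exists_eq_succ_of_ne_zero hpos.ne'
  rw [hc, Nat.pred_succ] at h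
  rw [hc, pow_succ]
  omega

end ProductEncoding

/-- There is an absolute constant `C` such that: for every finite
alphabet `α`, all `k ≥ 1`, `n ≥ 2`, `ℓ ≥ 1`, and all NFAs `M₁, …, M_k` over `α`, each
with exactly `n` states, there is a CNF formula `ψ` with at most
`C·(k + n + ℓ + |α|)^C` variables and clauses, together with a path decomposition of
width at most `(k + 1)·⌈log₂ n⌉ + |α| + C`, such that `ψ` is satisfiable iff there is a
word of length exactly `ℓ` accepted by every `Mᵢ`. -/
theorem stmt16 : ∃ C : ℕ, ∀ (α : Type) [Fintype α],
    ∀ (k n ℓ : ℕ) (M : Fin k → NFA α (Fin n)),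
    1 ≤ k → 2 ≤ n → 1 ≤ ℓ →
    ∃ (ψ : CNF) (B : List (Finset Var)),
      (cnfVars ψ).card ≤ C * (k + n + ℓ + Fintype.card α) ^ C ∧
      ψ.length ≤ C * (k + n + ℓ + Fintype.card α) ^ C ∧
      PD ψ ((k + 1) * Nat.clog 2 n + Fintype.card α + C) B ∧
      (Satisfiable ψ ↔ ∃ w : List α, w.length = ℓ ∧ ∀ i, w ∈ (M i).accepts) := by
  refine ⟨9, fun α _ k n ℓ M hk hn hℓ => ?_⟩
  obtain ⟨e, he⟩ := exists_injective_nat (VarName α (Nat.clog 2 n))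
  obtain ⟨dec, hdec⟩ := exists_surjective_bits (n := n) (by omega)
  have hcover : ∀ c ∈ (runClauses e dec ℓ M).toList, ∃ p < ℓ * k, clauseVars c ⊆ window e k p :=
    fun c hc => exists_window_of_mem_runClauses he hk hℓ c (Finset.mem_toList.1 hc)
  set s := k + n + ℓ + Fintype.card α with hs
  have hks : k ≤ s := by omega
  have hns : n ≤ s := by omega
  have hℓs : ℓ ≤ s := by omega
  have hαs : Fintype.card α ≤ s := by omega
  have hs1 : 1 ≤ s := by omega
  have hpow : ∀ i ≤ 9, s ^ i ≤ s ^ 9 := fun i hi => Nat.pow_le_pow_right hs1 hi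
  have h2b : 2 ^ Nat.clog 2 n ≤ 2 * s := (two_pow_clog_le hn).trans (by omega)
  have hb : Nat.clog 2 n ≤ s := (Nat.clog_le_of_le_pow Nat.lt_two_pow_self.le).trans hns
  refine ⟨(runClauses e dec ℓ M).toList, _, ?_, ?_,
    pd_of_windows hcover (fun i j r hij hjr x => window_interval he hij hjr)
      (fun i => (card_window_le e k i).trans (by omega)), satisfiable_runClauses_iff he hdec⟩
  · calc _ ≤ ℓ * k * ((k + 1) * Nat.clog 2 n + Fintype.card α) :=
          card_cnfVars_le_of_windows hcover (card_window_le e k)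
      _ ≤ s * s * ((s + 1) * s + s) := by gcongr
      _ = s ^ 4 + 2 * s ^ 3 := by ring
      _ ≤ 9 * s ^ 9 := by
        have := hpow 4 (by norm_num)
        have := hpow 3 (by norm_num)
        omega
  · rw [Finset.length_toList]
    calc _ ≤ _ := card_runClauses_le e dec M
      _ ≤ s + s * (2 * s) + s * (2 * s) + s * (s * (2 * s * (2 * s * s))) := by gcongr
      _ = s ^ 1 + 4 * s ^ 2 + 4 * s ^ 5 := by ring
      _ ≤ 9 * s ^ 9 := by
        have := hpow 1 (by norm_num)
        have := hpow 2 (by norm_num)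
        have := hpow 5 (by norm_num)
        omega

end PPSETH
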